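/- For every integer ℓ ≥ 2, every finite set of at least max{7, ℓ+2} points in the plane contains ℓ collinear points or a 4-hole (an empty quadrilateral). -/

import Mathlib

noncomputable section

/-- A point in the plane. -/
abbrev Pt : Type := EuclideanSpace ℝ (Fin 2)

noncomputable instance : DecidableEq Pt := Classical.decEq _

/-- A finite point set is in general position if no three of its points are collinear. -/
def GenPos (P : Finset Pt) : Prop :=
  ∀ S ⊆ P, S.card = 3 → ¬ Collinear ℝ (S : Set Pt)

/-- A finite point set is in convex position if every point lies on the boundary
of the convex hull of the set. -/
def ConvexPos (P : Finset Pt) : Prop :=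
  ∀ p ∈ P, p ∈ frontier (convexHull ℝ (P : Set Pt))

/-- `v` is a corner of `P` if removing it changes the convex hull. -/
def IsCornerOf (P : Finset Pt) (v : Pt) : Prop :=
  convexHull ℝ ((P : Set Pt) \ {v}) ≠ convexHull ℝ (P : Set Pt)

/-- A finite point set is in strictly convex position if each of its points is a corner. -/
def StrictConvexPos (P : Finset Pt) : Prop :=
  ∀ v ∈ P, IsCornerOf P v

/-- `P` contains `k` points in convex position. -/
def HasConvex (P : Finset Pt) (k : ℕ) : Prop :=
  ∃ S ⊆ P, S.card = k ∧ ConvexPos S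

/-- `P` contains `k` points in strictly convex position. -/
def HasStrictConvex (P : Finset Pt) (k : ℕ) : Prop :=
  ∃ S ⊆ P, S.card = k ∧ StrictConvexPos S

/-- `P` contains `l` collinear points. -/
def HasCollinear (P : Finset Pt) (l : ℕ) : Prop :=
  ∃ S ⊆ P, S.card = l ∧ Collinear ℝ (S : Set Pt)

/-- The Erdős–Szekeres number: the least `n` such that every finite set of at least `n`
points in general position contains `k` points in convex position. -/
def ES (k : ℕ) : ℕ :=
  sInf {n : ℕ | ∀ P : Finset Pt, GenPos P → n ≤ P.card → HasConvex P k}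

/-- `X` is a `k`-hole of `P`: `k` points of `P` in strictly convex position whose
convex hull contains no other point of `P`. -/
def IsHole (P X : Finset Pt) (k : ℕ) : Prop :=
  X ⊆ P ∧ X.card = k ∧ StrictConvexPos X ∧
    convexHull ℝ (X : Set Pt) ∩ (P : Set Pt) = (X : Set Pt)

/-- `v` and `w` are visible with respect to `P`. -/
def Visible (P : Finset Pt) (v w : Pt) : Prop :=
  v ≠ w ∧ (P : Set Pt) ∩ segment ℝ v w = {v, w}

end

noncomputable section

namespace S14

def D (a b c : Pt) : ℝ := (b 0 - a 0) * (c 1 - a 1) - (b 1 - a 1) * (c 0 - a 0)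

def SC (a b c d : Pt) : Prop := 0 < D a b c ∧ 0 < D b c d ∧ 0 < D c d a ∧ 0 < D d a b

def Btw (a r c : Pt) : Prop :=
  ∃ t : ℝ, 0 < t ∧ t < 1 ∧ r 0 = a 0 + t * (c 0 - a 0) ∧ r 1 = a 1 + t * (c 1 - a 1)

lemma pt_ext {a b : Pt} (h0 : a 0 = b 0) (h1 : a 1 = b 1) : a = b := by
  ext i; fin_cases i
  · exact h0
  · exact h1

lemma D_comb (x y p q : Pt) (s t : ℝ) (h : s + t = 1) :
    D x y (s • p + t • q) = s * D x y p + t * D x y q := by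
  obtain rfl : s = 1 - t := by linarith
  simp only [D, PiLp.add_apply, PiLp.smul_apply, smul_eq_mul]; ring

lemma convD (x y : Pt) : Convex ℝ {r : Pt | 0 ≤ D x y r} := by
  intro p hp q hq s t hs ht hst
  simp only [Set.mem_ofPred_eq] at *
  rw [D_comb _ _ _ _ _ _ hst]; positivity

lemma D_cyc (a b c : Pt) : D a b c = D b c a := by simp only [D]; ring
lemma D_swap (a b c : Pt) : D a b c = - D b a c := by simp only [D]; ring
lemma D_swap' (a b c : Pt) : D a b c = - D a c b := by simp only [D]; ring
lemma D_self1 (a b : Pt) : D a b a = 0 := by simp only [D]; ring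
lemma D_self2 (a b : Pt) : D a b b = 0 := by simp only [D]; ring
lemma D_self3 (a b : Pt) : D a a b = 0 := by simp only [D]; ring

lemma SC.rot {a b c d : Pt} (h : SC a b c d) : SC b c d a := ⟨h.2.1, h.2.2.1, h.2.2.2, h.1⟩

lemma SC.ne {a b c d : Pt} (h : SC a b c d) :
    a ≠ b ∧ a ≠ c ∧ a ≠ d ∧ b ≠ c ∧ b ≠ d ∧ c ≠ d := by
  obtain ⟨h1, h2, h3, h4⟩ := h
  refine ⟨?_, ?_, ?_, ?_, ?_, ?_⟩ <;> rintro rfl <;>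
    simp [D_self1, D_self2, D_self3] at h1 h2 h3 h4

lemma not_hull {a b c d : Pt} (h : SC a b c d) : a ∉ convexHull ℝ ({b, c, d} : Set Pt) := by
  intro ha
  have : convexHull ℝ ({b, c, d} : Set Pt) ⊆ {r : Pt | 0 ≤ D d b r} := by
    apply convexHull_min _ (convD d b)
    rintro x (rfl | rfl | rfl)
    · simp [D_self2]
    · have := h.2.1
      simp only [Set.mem_ofPred_eq]; rw [D_cyc]; exact this.le
    · simp [D_self1]
  have h1 := this ha
  have h2 := h.2.2.2
  simp only [Set.mem_ofPred_eq] at h1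
  rw [D_swap'] at h1; linarith

lemma corner {a b c d : Pt} (h : SC a b c d) (X : Finset Pt)
    (hX : (X : Set Pt) = {a, b, c, d}) : IsCornerOf X a := by
  intro he
  have h1 : a ∈ convexHull ℝ ((X : Set Pt) \ {a}) := by
    rw [he]; apply subset_convexHull; rw [hX]; simp
  apply not_hull h
  refine convexHull_mono ?_ h1
  rw [hX]
  rintro x ⟨hx, hx'⟩
  simp only [Set.mem_insert_iff, Set.mem_singleton_iff] at hx hx' ⊢
  tauto

lemma hole_of {P : Finset Pt} {a b c d : Pt} (h : SC a b c d) (ha : a ∈ P) (hb : b ∈ P)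
    (hc : c ∈ P) (hd : d ∈ P)
    (he : ∀ r ∈ P, r ∈ convexHull ℝ ({a, b, c, d} : Set Pt) → r = a ∨ r = b ∨ r = c ∨ r = d) :
    ∃ X : Finset Pt, IsHole P X 4 := by
  have hX : (({a, b, c, d} : Finset Pt) : Set Pt) = {a, b, c, d} := by simp
  obtain ⟨n1, n2, n3, n4, n5, n6⟩ := h.ne
  refine ⟨{a, b, c, d}, ?_, ?_, ?_, ?_⟩
  · intro x hx
    simp only [Finset.mem_insert, Finset.mem_singleton] at hx
    rcases hx with rfl | rfl | rfl | rfl <;> assumption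
  · simp [*]
  · intro v hv
    simp only [Finset.mem_insert, Finset.mem_singleton] at hv
    rcases hv with rfl | rfl | rfl | rfl
    · exact corner h _ hX
    · exact corner h.rot _ (by rw [hX]; ext; simp only [Set.mem_insert_iff, Set.mem_singleton_iff]; tauto)
    · exact corner h.rot.rot _ (by rw [hX]; ext; simp only [Set.mem_insert_iff, Set.mem_singleton_iff]; tauto)
    · exact corner h.rot.rot.rot _ (by rw [hX]; ext; simp only [Set.mem_insert_iff, Set.mem_singleton_iff]; tauto)
  · rw [hX]
    apply Set.Subset.antisymm
    · rintro r ⟨h1, h2⟩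
      exact he r h2 h1
    · intro r hr
      refine ⟨subset_convexHull _ _ hr, ?_⟩
      rcases hr with rfl | rfl | rfl | rfl <;> assumption

lemma hull_D {a b c d r : Pt} (h : SC a b c d) (hr : r ∈ convexHull ℝ ({a, b, c, d} : Set Pt)) :
    0 ≤ D a b r := by
  have : convexHull ℝ ({a, b, c, d} : Set Pt) ⊆ {r : Pt | 0 ≤ D a b r} := by
    apply convexHull_min _ (convD a b)
    obtain ⟨h1, h2, h3, h4⟩ := h
    rintro x (rfl | rfl | rfl | rfl)
    · simp [D_self1]
    · simp [D_self2]
    · exact h1.le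
    · simp only [Set.mem_ofPred_eq]; rw [← D_cyc]; exact h4.le
  exact this hr

lemma set_rot (a b c d : Pt) : ({a, b, c, d} : Set Pt) = {b, c, d, a} := by
  ext; simp only [Set.mem_insert_iff, Set.mem_singleton_iff]; tauto

lemma hull_D4 {a b c d r : Pt} (h : SC a b c d)
    (hr : r ∈ convexHull ℝ ({a, b, c, d} : Set Pt)) :
    0 ≤ D a b r ∧ 0 ≤ D b c r ∧ 0 ≤ D c d r ∧ 0 ≤ D d a r := by
  refine ⟨hull_D h hr, ?_, ?_, ?_⟩
  · rw [set_rot] at hr; exact hull_D h.rot hr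
  · rw [set_rot, set_rot] at hr; exact hull_D h.rot.rot hr
  · rw [set_rot, set_rot, set_rot] at hr; exact hull_D h.rot.rot.rot hr

/-- two lines through `b` meet only in `b` -/
lemma eq_of_two {a b c r : Pt} (h : D a b c ≠ 0) (h1 : D a b r = 0) (h2 : D b c r = 0) : r = b := by
  apply pt_ext
  · have : D a b c * (r 0 - b 0) = 0 := by
      have : D a b c * (r 0 - b 0) = (b 0 - a 0) * D b c r * (-1) + (c 0 - b 0) * D a b r := by
        simp only [D]; ring
      rw [this, h1, h2]; ring
    rcases mul_eq_zero.1 this with h' | h'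
    · exact absurd h' h
    · linarith
  · have : D a b c * (r 1 - b 1) = 0 := by
      have : D a b c * (r 1 - b 1) = (b 1 - a 1) * D b c r * (-1) + (c 1 - b 1) * D a b r := by
        simp only [D]; ring
      rw [this, h1, h2]; ring
    rcases mul_eq_zero.1 this with h' | h'
    · exact absurd h' h
    · linarith

lemma btw_of {a b c r : Pt} (h : 0 < D a b c) (h0 : D c a r = 0) (h1 : 0 < D a b r)
    (h2 : 0 < D b c r) : Btw a r c := by
  have hs : D a b r + D b c r + D c a r = D a b c := by simp only [D]; ring
  refine ⟨D a b r / D a b c, by positivity, by rw [div_lt_one h]; linarith, ?_, ?_⟩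
  · have : D a b c * (r 0 - a 0) = D a b r * (c 0 - a 0) := by
      have : D a b c * (r 0 - a 0) = D a b r * (c 0 - a 0) + (b 0 - a 0) * D c a r := by
        simp only [D]; ring
      rw [this, h0]; ring
    field_simp; linarith
  · have : D a b c * (r 1 - a 1) = D a b r * (c 1 - a 1) := by
      have : D a b c * (r 1 - a 1) = D a b r * (c 1 - a 1) + (b 1 - a 1) * D c a r := by
        simp only [D]; ring
      rw [this, h0]; ring
    field_simp; linarith

lemma btw_D {a r c : Pt} (h : Btw a r c) : ∃ t : ℝ, 0 < t ∧ t < 1 ∧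
    ∀ x y, D x y r = (1 - t) * D x y a + t * D x y c := by
  obtain ⟨t, h0, h1, e0, e1⟩ := h
  refine ⟨t, h0, h1, fun x y => ?_⟩
  simp only [D, e0, e1]; ring

/-- shrink `b` inside the triangle -/
lemma shrink {a b c d b' : Pt} (h : SC a b c d) (h1 : 0 ≤ D a b b') (h2 : 0 ≤ D b c b')
    (h3 : 0 < D c a b') : SC a b' c d := by
  obtain ⟨k1, k2, k3, k4⟩ := h
  refine ⟨by rw [D_cyc, D_cyc]; exact h3, ?_, k3, ?_⟩
  · have e : D b' c d * D a b c = D b c d * D c a b' + D b c b' * D c d a := by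
      simp only [D]; ring
    have : 0 < D b' c d * D a b c := by rw [e]; positivity
    exact pos_of_mul_pos_left this k1.le
  · have e : D d a b' * D a b c = D d a b * D c a b' + D a b b' * D c d a := by
      simp only [D]; ring
    have : 0 < D d a b' * D a b c := by rw [e]; positivity
    exact pos_of_mul_pos_left this k1.le

lemma exists_min {P : Finset Pt} {a b c : Pt} (hb : b ∈ P) (h : 0 < D a b c) :
    ∃ b' ∈ P, 0 ≤ D a b b' ∧ 0 ≤ D b c b' ∧ 0 < D c a b' ∧
      ∀ r ∈ P, 0 ≤ D a b' r → 0 ≤ D b' c r → 0 < D c a r → r = b' := by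
  classical
  have hne : (P.filter fun r => 0 ≤ D a b r ∧ 0 ≤ D b c r ∧ 0 < D c a r).Nonempty := by
    refine ⟨b, Finset.mem_filter.2 ⟨hb, ?_, ?_, ?_⟩⟩
    · simp [D_self2]
    · simp [D_self1]
    · rw [D_cyc]; exact h
  obtain ⟨b', hb', hmin⟩ := Finset.exists_min_image _ (fun r => D c a r) hne
  obtain ⟨hbP, h1, h2, h3⟩ := Finset.mem_filter.1 hb'
  refine ⟨b', hbP, h1, h2, h3, fun r hr r1 r2 r3 => ?_⟩
  have hc : 0 < D a b' c := by rw [D_cyc, D_cyc]; exact h3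
  have hs : D a b' r + D b' c r + D c a r = D c a b' := by simp only [D]; ring
  have m1 : 0 ≤ D a b r := by
    have e : D a b r * D a b' c = D a b c * D a b' r + D a b b' * D c a r := by
      simp only [D]; ring
    have : 0 ≤ D a b r * D a b' c := by rw [e]; positivity
    exact nonneg_of_mul_nonneg_left this hc
  have m2 : 0 ≤ D b c r := by
    have e : D b c r * D a b' c = D a b c * D b' c r + D b c b' * D c a r := by
      simp only [D]; ring
    have : 0 ≤ D b c r * D a b' c := by rw [e]; positivity
    exact nonneg_of_mul_nonneg_left this hc
  have := hmin r (Finset.mem_filter.2 ⟨hr, m1, m2, r3⟩)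
  exact eq_of_two hc.ne' (by linarith) (by linarith)

/-- Claim B -/
lemma claimB {P : Finset Pt} {a b c d : Pt} (h : SC a b c d) (ha : a ∈ P) (hb : b ∈ P)
    (hc : c ∈ P) (hd : d ∈ P) (hv : ∀ r ∈ P, ¬ Btw a r c) : ∃ X : Finset Pt, IsHole P X 4 := by
  obtain ⟨b', hb', b1, b2, b3, bm⟩ := exists_min hb h.1
  have h' := shrink h b1 b2 b3
  obtain ⟨d', hd', d1, d2, d3, dm⟩ := exists_min hd h'.2.2.1
  have h'' := (shrink h'.rot.rot d1 d2 d3).rot.rot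
  refine hole_of h'' ha hb' hc hd' fun r hr hh => ?_
  obtain ⟨r1, r2, r3, r4⟩ := hull_D4 h'' hh
  rcases lt_trichotomy (D c a r) 0 with h0 | h0 | h0
  · have := dm r hr r3 r4 (by rw [D_swap]; linarith)
    tauto
  · have hs : D a b' c ≠ 0 := h''.1.ne'
    rcases r1.eq_or_lt with r1 | r1
    · left
      refine eq_of_two (a := c) (c := b') ?_ h0 r1.symm
      rw [D_cyc]; exact hs
    · rcases r2.eq_or_lt with r2 | r2
      · right; right; left
        refine eq_of_two (a := b') (c := a) ?_ r2.symm h0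
        rw [← D_cyc]; exact hs
      · exact absurd (btw_of h''.1 h0 r1 r2) (hv r hr)
  · have := bm r hr r1 r2 h0
    tauto

def No4 (P : Finset Pt) : Prop := ∀ a ∈ P, ∀ b ∈ P, ∀ c ∈ P, ∀ d ∈ P,
  a ≠ b → a ≠ c → a ≠ d → b ≠ c → b ≠ d → c ≠ d → D a b c = 0 → D a b d = 0 → False

lemma Btw.symm {a r c : Pt} (h : Btw a r c) : Btw c r a := by
  obtain ⟨t, h0, h1, e0, e1⟩ := h
  exact ⟨1 - t, by linarith, by linarith, by rw [e0]; ring, by rw [e1]; ring⟩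

lemma Btw.ne {a r c : Pt} (h : Btw a r c) (hac : a ≠ c) : r ≠ a ∧ r ≠ c := by
  obtain ⟨t, h0, h1, e0, e1⟩ := h
  constructor
  · rintro rfl
    apply hac
    apply pt_ext
    · have : t * (c 0 - r 0) = 0 := by linarith
      rcases mul_eq_zero.1 this with h | h <;> linarith
    · have : t * (c 1 - r 1) = 0 := by linarith
      rcases mul_eq_zero.1 this with h | h <;> linarith
  · rintro rfl
    apply hac
    apply pt_ext
    · have : (1 - t) * (r 0 - a 0) = 0 := by linarith
      rcases mul_eq_zero.1 this with h | h <;> linarith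
    · have : (1 - t) * (r 1 - a 1) = 0 := by linarith
      rcases mul_eq_zero.1 this with h | h <;> linarith

/-- in a set without four collinear points, half of a blocked segment is visible -/
lemma vis_half {P : Finset Pt} (h4 : No4 P) {a e c : Pt} (ha : a ∈ P) (he : e ∈ P) (hc : c ∈ P)
    (hac : a ≠ c) (h : Btw a e c) : ∀ r ∈ P, ¬ Btw e r c := by
  intro r hr hb
  obtain ⟨n1, n2⟩ := h.ne hac
  obtain ⟨n3, n4⟩ := hb.ne n2
  obtain ⟨t, t0, t1, e0, e1⟩ := h
  obtain ⟨s, s0, s1, f0, f1⟩ := hb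
  have hra : r ≠ a := by
    have hk : 0 < 1 - (1 - s) * (1 - t) := by nlinarith
    rintro rfl
    apply hac
    rw [e0] at f0
    rw [e1] at f1
    apply pt_ext
    · have : (1 - (1 - s) * (1 - t)) * (c 0 - r 0) = 0 := by linarith
      rcases mul_eq_zero.1 this with h | h <;> linarith
    · have : (1 - (1 - s) * (1 - t)) * (c 1 - r 1) = 0 := by linarith
      rcases mul_eq_zero.1 this with h | h <;> linarith
  refine h4 a ha c hc e he r hr hac n1.symm hra.symm n2.symm n4.symm n3.symm ?_ ?_
  · simp only [D, e0, e1]; ring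
  · simp only [D, f0, f1, e0, e1]; ring

/-- Quadrant case of Lemma C, point inside the triangle. -/
lemma quad_in {P : Finset Pt} (h4 : No4 P) {a b c d e x : Pt} (h : SC a b c d)
    (hb : b ∈ P) (hc : c ∈ P) (hd : d ∈ P) (he : e ∈ P) (hx : x ∈ P)
    (e1 : Btw a e c) (e2 : Btw b e d) (x1 : 0 < D e a x) (x2 : 0 < D e x b) (x3 : 0 ≤ D a b x) :
    ∃ X : Finset Pt, IsHole P X 4 := by
  obtain ⟨n1, n2, n3, n4, n5, n6⟩ := h.ne
  have hv := vis_half h4 hd he hb n5.symm e2.symm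
  obtain ⟨t, t0, t1, et0, et1⟩ := e1
  have h1 := h.1
  have t1' : 0 < 1 - t := by linarith
  have hbc : 0 < D b c e := by
    have : D b c e = (1 - t) * D a b c := by simp only [D, et0, et1]; ring
    rw [this]; positivity
  have hT : 0 < D e a b := by
    have : D e a b = t * D a b c := by simp only [D, et0, et1]; ring
    rw [this]; positivity
  have hcx : 0 < D c e x := by
    have : t * D c e x = (1 - t) * D e a x := by simp only [D, et0, et1]; ring
    have h' : 0 < t * D c e x := by rw [this]; positivity
    exact pos_of_mul_pos_right h' t0.le
  have hbx : 0 < D x b c := by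
    have : D x b c * D e a b = D a b x * D b c e + D e x b * D a b c := by
      simp only [D]; ring
    have h' : 0 < D x b c * D e a b := by rw [this]; positivity
    exact pos_of_mul_pos_left h' hT.le
  have s : SC e x b c := ⟨x2, hbx, hbc, hcx⟩
  exact claimB s he hx hb hc hv

lemma quad_any {P : Finset Pt} (h4 : No4 P) {a b c d e x : Pt} (h : SC a b c d)
    (ha : a ∈ P) (hb : b ∈ P) (hc : c ∈ P) (hd : d ∈ P) (he : e ∈ P) (hx : x ∈ P)
    (e1 : Btw a e c) (e2 : Btw b e d) (x1 : 0 < D e a x) (x2 : 0 < D e x b) :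
    ∃ X : Finset Pt, IsHole P X 4 := by
  by_cases x3 : 0 ≤ D a b x
  · exact quad_in h4 h hb hc hd he hx e1 e2 x1 x2 x3
  push Not at x3
  have hT : 0 < D e a b := by
    obtain ⟨t, t0, t1, et0, et1⟩ := e1
    have : D e a b = t * D a b c := by simp only [D, et0, et1]; ring
    have h1 := h.1
    rw [this]; positivity
  have s : SC a x b e := by
    refine ⟨?_, ?_, ?_, x1⟩
    · rw [D_swap']; linarith
    · rw [← D_cyc]; exact x2
    · rw [D_cyc]; exact hT
  by_cases hv : ∀ r ∈ P, ¬ Btw a r b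
  · exact claimB s ha hx hb he hv
  push Not at hv
  obtain ⟨y, hy, hyb⟩ := hv
  obtain ⟨t, t0, t1, et0, et1⟩ := hyb
  have t1' : 0 < 1 - t := by linarith
  refine quad_in h4 h hb hc hd he hy e1 e2 ?_ ?_ ?_
  · have : D e a y = t * D e a b := by simp only [D, et0, et1]; ring
    rw [this]; positivity
  · have : D e y b = (1 - t) * D e a b := by simp only [D, et0, et1]; ring
    rw [this]; positivity
  · have : D a b y = 0 := by simp only [D, et0, et1]; ring
    rw [this]

lemma btw_opp {a e c : Pt} (h : Btw a e c) (x : Pt) :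
    ∃ k : ℝ, 0 < k ∧ D e c x = - (k * D e a x) := by
  obtain ⟨t, t0, t1, et0, et1⟩ := h
  have t1' : 0 < 1 - t := by linarith
  refine ⟨(1 - t) / t, by positivity, ?_⟩
  have : t * D e c x = -((1 - t) * D e a x) := by simp only [D, et0, et1]; ring
  field_simp; linarith

lemma off_line {P : Finset Pt} (h4 : No4 P) {a e c x : Pt} (ha : a ∈ P) (he : e ∈ P)
    (hc : c ∈ P) (hx : x ∈ P) (hac : a ≠ c) (h : Btw a e c) (xa : x ≠ a) (xe : x ≠ e)
    (xc : x ≠ c) : D e a x ≠ 0 := by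
  intro h0
  obtain ⟨n1, n2⟩ := h.ne hac
  refine h4 e he a ha c hc x hx n1 n2 xe.symm hac xa.symm xc.symm ?_ h0
  obtain ⟨t, t0, t1, et0, et1⟩ := h
  simp only [D, et0, et1]; ring

lemma lemmaC {P : Finset Pt} (h4 : No4 P) {a b c d e x : Pt} (h : SC a b c d)
    (ha : a ∈ P) (hb : b ∈ P) (hc : c ∈ P) (hd : d ∈ P) (he : e ∈ P) (hx : x ∈ P)
    (e1 : Btw a e c) (e2 : Btw b e d) (xa : x ≠ a) (xb : x ≠ b) (xc : x ≠ c) (xd : x ≠ d)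
    (xe : x ≠ e) : ∃ X : Finset Pt, IsHole P X 4 := by
  obtain ⟨n1, n2, n3, n4, n5, n6⟩ := h.ne
  have o1 := off_line h4 ha he hc hx n2 e1 xa xe xc
  have o2 := off_line h4 hb he hd hx n5 e2 xb xe xd
  obtain ⟨k, k0, hk⟩ := btw_opp e1 x
  obtain ⟨m, m0, hm⟩ := btw_opp e2 x
  rcases lt_or_gt_of_ne o1 with p1 | p1 <;> rcases lt_or_gt_of_ne o2 with p2 | p2
  · refine quad_any h4 h.rot.rot.rot hd ha hb hc he hx e2.symm e1 ?_ ?_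
    · rw [hm]; nlinarith
    · rw [D_swap']; linarith
  · refine quad_any h4 h.rot.rot hc hd ha hb he hx e1.symm e2.symm ?_ ?_
    · rw [hk]; nlinarith
    · rw [D_swap', hm]; nlinarith
  · refine quad_any h4 h ha hb hc hd he hx e1 e2 p1 ?_
    rw [D_swap']; linarith
  · refine quad_any h4 h.rot hb hc hd ha he hx e2 e1.symm p2 ?_
    rw [D_swap', hk]; nlinarith

lemma hole_of_SC {P : Finset Pt} (h4 : No4 P) (hP : 6 ≤ P.card) {a b c d : Pt} (h : SC a b c d)
    (ha : a ∈ P) (hb : b ∈ P) (hc : c ∈ P) (hd : d ∈ P) : ∃ X : Finset Pt, IsHole P X 4 := by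
  obtain ⟨n1, n2, n3, n4, n5, n6⟩ := h.ne
  by_cases hv : ∀ r ∈ P, ¬ Btw a r c
  · exact claimB h ha hb hc hd hv
  push Not at hv
  obtain ⟨e, he, hb1⟩ := hv
  obtain ⟨k1, k2, k3, k4⟩ := h
  have hb1' := hb1
  obtain ⟨t, t0, t1, et0, et1⟩ := hb1'
  have t1' : 0 < 1 - t := by linarith
  have a1 : 0 < D e b c := by
    have : D e b c = (1 - t) * D a b c := by simp only [D, et0, et1]; ring
    rw [this]; positivity
  have a2 : 0 < D c d e := by
    have : D c d e = (1 - t) * D c d a := by simp only [D, et0, et1]; ring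
    rw [this]; positivity
  have a3 : 0 < D a b e := by
    have : D a b e = t * D a b c := by simp only [D, et0, et1]; ring
    rw [this]; positivity
  have a4 : 0 < D e d a := by
    have : D e d a = t * D c d a := by simp only [D, et0, et1]; ring
    rw [this]; positivity
  rcases lt_trichotomy (D d e b) 0 with h0 | h0 | h0
  · refine claimB (a := a) (b := b) (c := e) (d := d) ⟨a3, ?_, a4, k4⟩ ha hb he hd ?_
    · have : D b e d = - D d e b := by simp only [D]; ring
      linarith
    · intro r hr hh
      exact vis_half h4 hc he ha n2.symm hb1.symm r hr hh.symm
  · have hb2 : Btw b e d := by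
      refine btw_of (b := c) k2 ?_ ?_ ?_
      · rw [D_swap', h0, neg_zero]
      · rw [← D_cyc]; exact a1
      · exact a2
    have : ∃ x ∈ P, x ∉ ({a, b, c, d, e} : Finset Pt) := by
      by_contra hcon
      push Not at hcon
      have := Finset.card_le_card (show P ⊆ {a, b, c, d, e} from hcon)
      have := Finset.card_le_five (a := a) (b := b) (c := c) (d := d) (e := e)
      omega
    obtain ⟨x, hx, hxn⟩ := this
    simp only [Finset.mem_insert, Finset.mem_singleton, not_or] at hxn
    obtain ⟨q1, q2, q3, q4, q5⟩ := hxn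
    exact lemmaC h4 ⟨k1, k2, k3, k4⟩ ha hb hc hd he hx hb1 hb2 q1 q2 q3 q4 q5
  · exact claimB (a := e) (b := b) (c := c) (d := d) ⟨a1, k2, a2, h0⟩ he hb hc hd
      (vis_half h4 ha he hc n2 hb1)

def NoSC (P : Finset Pt) : Prop := ∀ a ∈ P, ∀ b ∈ P, ∀ c ∈ P, ∀ d ∈ P, ¬ SC a b c d

structure Tri (P : Finset Pt) (A B C : Pt) : Prop where
  n4 : No4 P
  ns : NoSC P
  hA : A ∈ P
  hB : B ∈ P
  hC : C ∈ P
  pos : 0 < D A B C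
  u : ∀ r ∈ P, 0 ≤ D A B r
  v : ∀ r ∈ P, 0 ≤ D B C r
  w : ∀ r ∈ P, 0 ≤ D C A r

lemma Tri.rot {P : Finset Pt} {A B C : Pt} (h : Tri P A B C) : Tri P B C A :=
  ⟨h.n4, h.ns, h.hB, h.hC, h.hA, by rw [← D_cyc]; exact h.pos, h.v, h.w, h.u⟩

lemma sumD (A B C r : Pt) : D A B r + D B C r + D C A r = D A B C := by simp only [D]; ring

lemma exists_tri {P : Finset Pt} (h4 : No4 P) (hs : NoSC P) (hP : 4 ≤ P.card) :
    ∃ A B C, Tri P A B C := by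
  classical
  have hne : (P ×ˢ P ×ˢ P).Nonempty := by
    have : P.Nonempty := Finset.card_pos.1 (by omega)
    exact this.product (this.product this)
  obtain ⟨⟨A, B, C⟩, hm, hmax⟩ := Finset.exists_max_image _ (fun p => D p.1 p.2.1 p.2.2) hne
  simp only [Finset.mem_product] at hm
  obtain ⟨hA, hB, hC⟩ := hm
  have hmax' : ∀ a ∈ P, ∀ b ∈ P, ∀ c ∈ P, D a b c ≤ D A B C := fun a ha b hb c hc =>
    hmax (a, b, c) (by simp [ha, hb, hc])
  have hT : 0 < D A B C := by
    by_contra hcon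
    push Not at hcon
    have hz : ∀ a ∈ P, ∀ b ∈ P, ∀ c ∈ P, D a b c = 0 := by
      intro a ha b hb c hc
      have h1 := hmax' a ha b hb c hc
      have h2 := hmax' b hb a ha c hc
      rw [D_swap] at h2
      linarith
    obtain ⟨S, hS, hc⟩ := Finset.exists_subset_card_eq hP
    obtain ⟨a, b, c, d, n1, n2, n3, n4, n5, n6, rfl⟩ := Finset.card_eq_four.1 hc
    have ha : a ∈ P := hS (by simp)
    have hb : b ∈ P := hS (by simp)
    have hc : c ∈ P := hS (by simp)
    have hd : d ∈ P := hS (by simp)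
    exact h4 a ha b hb c hc d hd n1 n2 n3 n4 n5 n6 (hz _ ha _ hb _ hc) (hz _ ha _ hb _ hd)
  have key : ∀ A ∈ P, ∀ B ∈ P, ∀ C ∈ P, 0 < D A B C →
      (∀ a ∈ P, ∀ b ∈ P, ∀ c ∈ P, D a b c ≤ D A B C) → ∀ r ∈ P, 0 ≤ D A B r := by
    intro A hA B hB C hC hT hmax r hr
    by_contra hcon
    push Not at hcon
    have h1 := hmax B hB C hC r hr
    have h2 := hmax C hC A hA r hr
    have h3 := sumD A B C r
    refine hs A hA r hr B hB C hC ⟨?_, ?_, ?_, ?_⟩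
    · rw [D_swap']; linarith
    · rw [D_cyc]; linarith
    · rw [← D_cyc]; linarith
    · linarith
  have c1 : D B C A = D A B C := (D_cyc A B C).symm
  have c2 : D C A B = D A B C := by rw [D_cyc]
  refine ⟨A, B, C, h4, hs, hA, hB, hC, hT, key A hA B hB C hC hT hmax',
    key B hB C hC A hA (by rw [c1]; exact hT) (by rw [c1]; exact hmax'),
    key C hC A hA B hB (by rw [c2]; exact hT) (by rw [c2]; exact hmax')⟩

/-- same sign corners force a corner point -/
lemma Tri.same {P : Finset Pt} {A B C x y : Pt} (h : Tri P A B C) (hx : x ∈ P) (hy : y ∈ P)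
    (p : 0 < D A x y) (q : 0 < D B x y) : D C x y ≤ 0 → False := by
  intro _
  have hT := h.pos
  have r1 : D B C x * D A x y + D C A x * D B x y + D A B x * D C x y = 0 := by
    simp only [D]; ring
  have r2 : D B C y * D A x y + D C A y * D B x y + D A B y * D C x y = 0 := by
    simp only [D]; ring
  have s1 := sumD A B C x
  have s2 := sumD A B C y
  have v1 := h.v x hx
  have v2 := h.v y hy
  have w1 := h.w x hx
  have w2 := h.w y hy
  rcases (h.u x hx).eq_or_lt with u1 | u1
  · rw [← u1] at r1 s1
    have : 0 < D B C x ∨ 0 < D C A x := by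
      by_contra hc; push Not at hc; linarith
    rcases this with h' | h' <;> nlinarith [mul_nonneg v1 p.le, mul_nonneg w1 q.le, mul_pos h' p, mul_pos h' q]
  rcases (h.u y hy).eq_or_lt with u2 | u2
  · rw [← u2] at r2 s2
    have : 0 < D B C y ∨ 0 < D C A y := by
      by_contra hc; push Not at hc; linarith
    rcases this with h' | h' <;> nlinarith [mul_nonneg v2 p.le, mul_nonneg w2 q.le, mul_pos h' p, mul_pos h' q]
  refine h.ns x hx y hy A h.hA B h.hB ⟨?_, ?_, u1, ?_⟩
  · rw [← D_cyc]; exact p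
  · rw [D_cyc]; exact u2
  · exact q

lemma Tri.pair' {P : Finset Pt} {A B C x y : Pt} (h : Tri P A B C) (hx : x ∈ P) (hy : y ∈ P)
    (p : 0 < D A x y) (q : 0 < D B x y) : False := by
  by_cases hC : D C x y ≤ 0
  · exact h.same hx hy p q hC
  push Not at hC
  have hT := h.pos
  have r1 : D B C x * D A x y + D C A x * D B x y + D A B x * D C x y = 0 := by
    simp only [D]; ring
  have s1 := sumD A B C x
  have u1 := h.u x hx
  have v1 := h.v x hx
  have w1 := h.w x hx
  have a1 := mul_nonneg v1 p.le
  have a2 := mul_nonneg w1 q.le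
  have a3 := mul_nonneg u1 hC.le
  have b1 : D B C x * D A x y = 0 := by linarith
  have b2 : D C A x * D B x y = 0 := by linarith
  have b3 : D A B x * D C x y = 0 := by linarith
  have c1 := (mul_eq_zero.1 b1).resolve_right p.ne'
  have c2 := (mul_eq_zero.1 b2).resolve_right q.ne'
  have c3 := (mul_eq_zero.1 b3).resolve_right hC.ne'
  linarith

lemma Tri.pair {P : Finset Pt} {A B C x y : Pt} (h : Tri P A B C) (hx : x ∈ P) (hy : y ∈ P) :
    D A x y = 0 ∨ D B x y = 0 ∨ D C x y = 0 := by
  by_contra hcon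
  push Not at hcon
  obtain ⟨h1, h2, h3⟩ := hcon
  have sA : D A y x = - D A x y := D_swap' _ _ _
  have sB : D B y x = - D B x y := D_swap' _ _ _
  have sC : D C y x = - D C x y := D_swap' _ _ _
  rcases lt_or_gt_of_ne h1 with p1 | p1 <;> rcases lt_or_gt_of_ne h2 with p2 | p2 <;>
    rcases lt_or_gt_of_ne h3 with p3 | p3 <;>
  first
  | exact h.pair' hx hy p1 p2
  | exact h.rot.pair' hx hy p2 p3
  | exact h.rot.rot.pair' hx hy p3 p1
  | exact h.pair' hy hx (by linarith) (by linarith)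
  | exact h.rot.pair' hy hx (by linarith) (by linarith)
  | exact h.rot.rot.pair' hy hx (by linarith) (by linarith)

def NC (P : Finset Pt) (A B C x : Pt) : Prop := x ∈ P ∧ x ≠ A ∧ x ≠ B ∧ x ≠ C

lemma Tri.ne {P : Finset Pt} {A B C : Pt} (h : Tri P A B C) : A ≠ B ∧ A ≠ C ∧ B ≠ C := by
  have hT := h.pos
  refine ⟨?_, ?_, ?_⟩ <;> rintro rfl <;> simp [D_self1, D_self2, D_self3] at hT

/-- a non-corner point is interior -/
lemma Tri.int {P : Finset Pt} {A B C s x y : Pt} (h : Tri P A B C) (hs : NC P A B C s)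
    (hx : NC P A B C x) (hy : NC P A B C y) (sx : s ≠ x) (sy : s ≠ y) (xy : x ≠ y) :
    0 < D A B s := by
  obtain ⟨n1, n2, n3⟩ := h.ne
  rcases (h.u s hs.1).eq_or_lt with u0 | u0
  swap
  · exact u0
  exfalso
  have hT := h.pos
  have hv : D B C s ≠ 0 := fun h0 => hs.2.2.1 (eq_of_two hT.ne' u0.symm h0)
  have hw : D C A s ≠ 0 := fun h0 => hs.2.1
    (eq_of_two (a := C) (c := B) (by rw [D_cyc]; exact hT.ne') h0 u0.symm)
  have key : ∀ x, NC P A B C x → s ≠ x → D C s x = 0 := by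
    intro x hx sx
    have hu : D A B x ≠ 0 := fun h0 =>
      h.n4 A h.hA B h.hB s hs.1 x hx.1 n1 hs.2.1.symm hx.2.1.symm hs.2.2.1.symm hx.2.2.1.symm
        sx u0.symm h0
    rcases h.pair hs.1 hx.1 with h0 | h0 | h0
    · exfalso
      have : D A s x * D A B C = D C A s * D A B x - D A B s * D C A x := by simp only [D]; ring
      rw [h0, ← u0] at this
      have : D C A s * D A B x = 0 := by linarith
      exact (mul_ne_zero hw hu) this
    · exfalso
      have : D B s x * D A B C = D A B s * D B C x - D B C s * D A B x := by simp only [D]; ring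
      rw [h0, ← u0] at this
      have : D B C s * D A B x = 0 := by linarith
      exact (mul_ne_zero hv hu) this
    · exact h0
  exact h.n4 C h.hC s hs.1 x hx.1 y hy.1 hs.2.2.2.symm hx.2.2.2.symm hy.2.2.2.symm sx sy xy
    (key x hx sx) (key y hy sy)

lemma real_core {a1 b1 c1 a2 b2 c2 a3 b3 c3 a4 b4 c4 : ℝ} (pa1 : 0 < a1) (pb1 : 0 < b1)
    (pa2 : 0 < a2) (pb2 : 0 < b2) (pc2 : 0 < c2) (pa3 : 0 < a3)
    (pb3 : 0 < b3) (pc1 : 0 < c1) (pa4 : 0 < a4) (pb4 : 0 < b4)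
    (h1 : b1 * c2 = c1 * b2) (h2 : b3 * c4 = c3 * b4)
    (h3 : c1 * a3 = a1 * c3) (h4 : c2 * a4 = a2 * c4)
    (h5 : a1 * b4 = b1 * a4) (h6 : a2 * b3 = b2 * a3) : c1 * a2 = a1 * c2 := by
  obtain ⟨b, hb⟩ : ∃ b, b = c1 / a1 := ⟨_, rfl⟩
  obtain ⟨b', hb'⟩ : ∃ b', b' = c2 / a2 := ⟨_, rfl⟩
  obtain ⟨c, hc⟩ : ∃ c, c = a1 / b1 := ⟨_, rfl⟩
  obtain ⟨c', hc'⟩ : ∃ c', c' = a2 / b2 := ⟨_, rfl⟩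
  have pb : 0 < b := by rw [hb]; positivity
  have pb' : 0 < b' := by rw [hb']; positivity
  have pc : 0 < c := by rw [hc]; positivity
  have pc' : 0 < c' := by rw [hc']; positivity
  have e1 : c1 = b * a1 := by rw [hb]; field_simp
  have e2 : c2 = b' * a2 := by rw [hb']; field_simp
  have e3 : c3 = b * a3 := by rw [hb]; field_simp; linarith
  have e4 : c4 = b' * a4 := by rw [hb']; field_simp; linarith
  have f1 : a1 = c * b1 := by rw [hc]; field_simp
  have f2 : a2 = c' * b2 := by rw [hc']; field_simp
  have f3 : a3 = c' * b3 := by rw [hc']; field_simp; linarith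
  have f4 : a4 = c * b4 := by rw [hc]; field_simp; linarith
  have g1 : b' * c' = b * c := by
    have : (b1 * b2) * (b' * c') = (b1 * b2) * (b * c) := by
      rw [e1, e2, f1, f2] at h1; linarith
    exact mul_left_cancel₀ (by positivity) this
  have g2 : b' * c = b * c' := by
    have : (b3 * b4) * (b' * c) = (b3 * b4) * (b * c') := by
      rw [e3, e4, f3, f4] at h2; linarith
    exact mul_left_cancel₀ (by positivity) this
  have g3 : b' * b' = b * b := by
    have : (c * c') * (b' * b') = (c * c') * (b * b) := by
      calc (c * c') * (b' * b') = (b' * c') * (b' * c) := by ring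
        _ = (b * c) * (b * c') := by rw [g1, g2]
        _ = _ := by ring
    exact mul_left_cancel₀ (by positivity) this
  have g4 : b' = b := by nlinarith
  rw [e1, e2, g4]; ring

lemma Tri.core {P : Finset Pt} {A B C x y z w : Pt} (h : Tri P A B C) (hx : NC P A B C x)
    (hy : NC P A B C y) (hz : NC P A B C z) (hw : NC P A B C w) (xy : x ≠ y) (xz : x ≠ z)
    (xw : x ≠ w) (yz : y ≠ z) (yw : y ≠ w) (zw : z ≠ w)
    (h1 : D A x y = 0) (h2 : D A z w = 0) (h3 : D B x z = 0) (h4 : D B y w = 0)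
    (h5 : D C x w = 0) (h6 : D C y z = 0) : False := by
  have hT := h.pos
  have rt : ∀ {x}, NC P A B C x → NC P B C A x := fun h => ⟨h.1, h.2.2.1, h.2.2.2, h.2.1⟩
  have rt2 : ∀ {x}, NC P A B C x → NC P C A B x := fun h => ⟨h.1, h.2.2.2, h.2.1, h.2.2.1⟩
  have iA : ∀ p q, D A p q * D A B C = D C A p * D A B q - D A B p * D C A q := by
    intro p q; simp only [D]; ring
  have iB : ∀ p q, D B p q * D A B C = D A B p * D B C q - D B C p * D A B q := by
    intro p q; simp only [D]; ring
  have iC : ∀ p q, D C p q * D A B C = D B C p * D C A q - D C A p * D B C q := by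
    intro p q; simp only [D]; ring
  have j1 := iA x y
  have j2 := iA z w
  have j3 := iB x z
  have j4 := iB y w
  have j5 := iC x w
  have j6 := iC y z
  rw [h1] at j1
  rw [h2] at j2
  rw [h3] at j3
  rw [h4] at j4
  rw [h5] at j5
  rw [h6] at j6
  have := real_core (a1 := D B C x) (a2 := D B C y) (a3 := D B C z) (a4 := D B C w)
    (b1 := D C A x) (b2 := D C A y) (b3 := D C A z) (b4 := D C A w)
    (c1 := D A B x) (c2 := D A B y) (c3 := D A B z) (c4 := D A B w)
    (h.rot.int (rt hx) (rt hy) (rt hz) xy xz yz) (h.rot.rot.int (rt2 hx) (rt2 hy) (rt2 hz) xy xz yz)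
    (h.rot.int (rt hy) (rt hx) (rt hz) xy.symm yz xz)
    (h.rot.rot.int (rt2 hy) (rt2 hx) (rt2 hz) xy.symm yz xz)
    (h.int hy hx hz xy.symm yz xz)
    (h.rot.int (rt hz) (rt hx) (rt hy) xz.symm yz.symm xy)
    (h.rot.rot.int (rt2 hz) (rt2 hx) (rt2 hy) xz.symm yz.symm xy)
    (h.int hx hy hz xy xz yz)
    (h.rot.int (rt hw) (rt hx) (rt hy) xw.symm yw.symm xy)
    (h.rot.rot.int (rt2 hw) (rt2 hx) (rt2 hy) xw.symm yw.symm xy)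
    (by linarith) (by linarith) (by linarith) (by linarith) (by linarith) (by linarith)
  have hB : D B x y * D A B C = 0 := by rw [iB]; linarith
  have hB' := (mul_eq_zero.1 hB).resolve_right hT.ne'
  exact h.n4 B h.hB x hx.1 y hy.1 z hz.1 hx.2.2.1.symm hy.2.2.1.symm hz.2.2.1.symm xy xz yz
    hB' h3

lemma Tri.final {P : Finset Pt} {A B C x y z w : Pt} (h : Tri P A B C) (hx : NC P A B C x)
    (hy : NC P A B C y) (hz : NC P A B C z) (hw : NC P A B C w) (xy : x ≠ y) (xz : x ≠ z)
    (xw : x ≠ w) (yz : y ≠ z) (yw : y ≠ w) (zw : z ≠ w) : False := by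
  have ns : ∀ Q, Q = A ∨ Q = B ∨ Q = C → ∀ x y z, NC P A B C x → NC P A B C y → NC P A B C z →
      x ≠ y → x ≠ z → y ≠ z → D Q x y = 0 → D Q x z = 0 → False := by
    intro Q hQ x y z hx hy hz xy xz yz h1 h2
    obtain ⟨m, q1, q2, q3⟩ : Q ∈ P ∧ Q ≠ x ∧ Q ≠ y ∧ Q ≠ z := by
      rcases hQ with rfl | rfl | rfl
      · exact ⟨h.hA, hx.2.1.symm, hy.2.1.symm, hz.2.1.symm⟩
      · exact ⟨h.hB, hx.2.2.1.symm, hy.2.2.1.symm, hz.2.2.1.symm⟩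
      · exact ⟨h.hC, hx.2.2.2.symm, hy.2.2.2.symm, hz.2.2.2.symm⟩
    exact h.n4 Q m x hx.1 y hy.1 z hz.1 q1 q2 q3 xy xz yz h1 h2
  have sw : ∀ Q x y, D Q x y = 0 → D Q y x = 0 := by
    intro Q x y h; rw [D_swap', h, neg_zero]
  -- colours of pairs at a vertex, and the remaining pairs
  have tri : ∀ x y z, NC P A B C x → NC P A B C y → NC P A B C z → x ≠ y → x ≠ z → y ≠ z →
      (D A x y = 0 → D B x z = 0 → D C y z = 0) ∧ (D A x y = 0 → D C x z = 0 → D B y z = 0) ∧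
      (D B x y = 0 → D C x z = 0 → D A y z = 0) := by
    intro x y z hx hy hz xy xz yz
    refine ⟨fun h1 h2 => ?_, fun h1 h2 => ?_, fun h1 h2 => ?_⟩ <;>
    rcases h.pair hy.1 hz.1 with h3 | h3 | h3
    · exact (ns A (by simp) y x z hy hx hz xy.symm yz xz (sw _ _ _ h1) h3).elim
    · exact (ns B (by simp) z x y hz hx hy xz.symm yz.symm xy (sw _ _ _ h2) (sw _ _ _ h3)).elim
    · exact h3
    · exact (ns A (by simp) y x z hy hx hz xy.symm yz xz (sw _ _ _ h1) h3).elim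
    · exact h3
    · exact (ns C (by simp) z x y hz hx hy xz.symm yz.symm xy (sw _ _ _ h2) (sw _ _ _ h3)).elim
    · exact h3
    · exact (ns B (by simp) y x z hy hx hz xy.symm yz xz (sw _ _ _ h1) h3).elim
    · exact (ns C (by simp) z x y hz hx hy xz.symm yz.symm xy (sw _ _ _ h2) (sw _ _ _ h3)).elim
  have main : ∀ x y z w, NC P A B C x → NC P A B C y → NC P A B C z → NC P A B C w →
      x ≠ y → x ≠ z → x ≠ w → y ≠ z → y ≠ w → z ≠ w →
      D A x y = 0 → D B x z = 0 → D C x w = 0 → False := by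
    intro x y z w hx hy hz hw xy xz xw yz yw zw h1 h2 h3
    exact h.core hx hy hz hw xy xz xw yz yw zw h1 ((tri x z w hx hz hw xz xw zw).2.2 h2 h3) h2
      ((tri x y w hx hy hw xy xw yw).2.1 h1 h3) h3 ((tri x y z hx hy hz xy xz yz).1 h1 h2)
  rcases h.pair hx.1 hy.1 with h1 | h1 | h1 <;> rcases h.pair hx.1 hz.1 with h2 | h2 | h2 <;>
    first
    | exact ns _ (by simp) x y z hx hy hz xy xz yz h1 h2
    | rcases h.pair hx.1 hw.1 with h3 | h3 | h3 <;>
      first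
      | exact ns _ (by simp) x y w hx hy hw xy xw yw h1 h3
      | exact ns _ (by simp) x z w hx hz hw xz xw zw h2 h3
      | exact main x y z w hx hy hz hw xy xz xw yz yw zw h1 h2 h3
      | exact main x y w z hx hy hw hz xy xw xz yw yz zw.symm h1 h3 h2
      | exact main x z y w hx hz hy hw xz xy xw yz.symm zw yw h2 h1 h3
      | exact main x z w y hx hz hw hy xz xw xy zw yz.symm yw.symm h2 h3 h1
      | exact main x w y z hx hw hy hz xw xy xz yw.symm zw.symm yz h3 h1 h2
      | exact main x w z y hx hw hz hy xw xz xy zw.symm yw.symm yz.symm h3 h2 h1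

lemma case2 {P : Finset Pt} (h4 : No4 P) (hP : 7 ≤ P.card) : ∃ X : Finset Pt, IsHole P X 4 := by
  by_cases hs : NoSC P
  · exfalso
    obtain ⟨A, B, C, h⟩ := exists_tri h4 hs (by omega)
    have hc : 4 ≤ (P \ {A, B, C}).card := by
      have := Finset.le_card_sdiff {A, B, C} P
      have := Finset.card_le_three (a := A) (b := B) (c := C)
      omega
    obtain ⟨S, hS, hc⟩ := Finset.exists_subset_card_eq hc
    obtain ⟨a, b, c, d, n1, n2, n3, n4, n5, n6, rfl⟩ := Finset.card_eq_four.1 hc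
    have nc : ∀ x ∈ ({a, b, c, d} : Finset Pt), NC P A B C x := by
      intro x hx
      have := hS hx
      simp only [Finset.mem_sdiff, Finset.mem_insert, Finset.mem_singleton, not_or] at this
      exact ⟨this.1, this.2.1, this.2.2.1, this.2.2.2⟩
    exact h.final (nc a (by simp)) (nc b (by simp)) (nc c (by simp)) (nc d (by simp))
      n1 n2 n3 n4 n5 n6
  · simp only [NoSC] at hs
    push Not at hs
    obtain ⟨a, ha, b, hb, c, hc, d, hd, h⟩ := hs
    exact hole_of_SC h4 (by omega) h ha hb hc hd

def G (p q r : Pt) : ℝ := (q 0 - p 0) * r 0 + (q 1 - p 1) * r 1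

def K (p q : Pt) : ℝ := (q 0 - p 0) ^ 2 + (q 1 - p 1) ^ 2

lemma K_pos {p q : Pt} (h : p ≠ q) : 0 < K p q := by
  unfold K
  by_contra hc
  push Not at hc
  have h0 : (q 0 - p 0) ^ 2 = 0 := by nlinarith [sq_nonneg (q 0 - p 0), sq_nonneg (q 1 - p 1)]
  have h1 : (q 1 - p 1) ^ 2 = 0 := by nlinarith [sq_nonneg (q 0 - p 0), sq_nonneg (q 1 - p 1)]
  apply h
  apply pt_ext
  · have := pow_eq_zero_iff (two_ne_zero) |>.1 h0
    linarith
  · have := pow_eq_zero_iff (two_ne_zero) |>.1 h1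
    linarith

lemma KD (p q x y z : Pt) : K p q * D x y z =
    (G p q y - G p q x) * (D p q z - D p q x) - (D p q y - D p q x) * (G p q z - G p q x) := by
  simp only [K, D, G]; ring

lemma GH_ext {p q r s : Pt} (h : p ≠ q) (hH : D p q r = D p q s) (hG : G p q r = G p q s) :
    r = s := by
  have hK := K_pos h
  apply pt_ext
  · have : K p q * (r 0 - s 0) = 0 := by
      have : K p q * (r 0 - s 0) = (q 0 - p 0) * (G p q r - G p q s)
          - (q 1 - p 1) * (D p q r - D p q s) := by simp only [K, D, G]; ring
      rw [this, hH, hG]; ring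
    have := (mul_eq_zero.1 this).resolve_left hK.ne'
    linarith
  · have : K p q * (r 1 - s 1) = 0 := by
      have : K p q * (r 1 - s 1) = (q 1 - p 1) * (G p q r - G p q s)
          + (q 0 - p 0) * (D p q r - D p q s) := by simp only [K, D, G]; ring
      rw [this, hH, hG]; ring
    have := (mul_eq_zero.1 this).resolve_left hK.ne'
    linarith

def Le (p q a r : Pt) : Prop := D p q a < D p q r ∨ (D p q a = D p q r ∧ G p q a ≤ G p q r)

lemma exists_lex (p q : Pt) (S : Finset Pt) (hS : S.Nonempty) : ∃ a ∈ S, ∀ r ∈ S, Le p q a r := by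
  obtain ⟨a, ha, h⟩ := Finset.exists_min_image S (fun r => toLex (D p q r, G p q r)) hS
  refine ⟨a, ha, fun r hr => ?_⟩
  have := h r hr
  rw [Prod.Lex.toLex_le_toLex] at this
  exact this

lemma convLe (p q m : Pt) : Convex ℝ {r : Pt | Le p q r m} := by
  intro x hx y hy s t hs ht hst
  simp only [Set.mem_ofPred_eq, Le] at *
  have hG : G p q (s • x + t • y) = s * G p q x + t * G p q y := by
    simp only [G, PiLp.add_apply, PiLp.smul_apply, smul_eq_mul]; ring
  rw [D_comb _ _ _ _ _ _ hst, hG]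
  obtain rfl : s = 1 - t := by linarith
  rcases hs.eq_or_lt with h0 | h0
  · obtain rfl : t = 1 := by linarith
    simpa using hy
  rcases ht.eq_or_lt with h1 | h1
  · subst h1
    simpa using hx
  rcases hx with hx | ⟨hx, hx'⟩ <;> rcases hy with hy | ⟨hy, hy'⟩
  · left; nlinarith
  · left; nlinarith
  · left; nlinarith
  · right; constructor
    · rw [hx, hy]; ring
    · nlinarith

lemma c1 {P : Finset Pt} {p0 q0 a b m : Pt} (hpq : p0 ≠ q0) (ha : a ∈ P) (hb : b ∈ P)
    (ha0 : 0 < D p0 q0 a) (hb0 : 0 < D p0 q0 b) (hm0 : 0 < D p0 q0 m)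
    (ham : Le p0 q0 a m) (hbm : Le p0 q0 b m)
    (hm : ∀ r ∈ P, 0 < D p0 q0 r → Le p0 q0 r m → r = a ∨ r = b)
    (hF : 2 ≤ (P.filter fun r => D p0 q0 r = 0 ∧ 0 < D a b r).card) :
    ∃ X : Finset Pt, IsHole P X 4 := by
  have hK := K_pos hpq
  set F := P.filter fun r => D p0 q0 r = 0 ∧ 0 < D a b r with hFdef
  obtain ⟨p, hp, pmin⟩ := Finset.exists_min_image F (G p0 q0) (Finset.card_pos.1 (by omega))
  obtain ⟨q, hq, qmin⟩ := Finset.exists_min_image (F.erase p) (G p0 q0)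
    (Finset.card_pos.1 (by rw [Finset.card_erase_of_mem hp]; omega))
  obtain ⟨hqp, hq⟩ := Finset.mem_erase.1 hq
  have hGle := pmin q hq
  obtain ⟨hpP, hp0, hpab⟩ := Finset.mem_filter.1 hp
  obtain ⟨hqP, hq0, hqab⟩ := Finset.mem_filter.1 hq
  have hGlt : G p0 q0 p < G p0 q0 q := lt_of_le_of_ne hGle
    fun h => hqp (GH_ext hpq (hq0.trans hp0.symm) h.symm)
  have pos_of : ∀ {z : ℝ}, 0 < K p0 q0 * z → 0 < z := fun h => pos_of_mul_pos_right h hK.le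
  have s : SC p q a b := by
    refine ⟨?_, ?_, hpab, ?_⟩
    · apply pos_of
      rw [KD, hp0, hq0]
      have : 0 < (G p0 q0 q - G p0 q0 p) * D p0 q0 a := mul_pos (by linarith) ha0
      linarith
    · rw [D_cyc]; exact hqab
    · rw [D_cyc]
      apply pos_of
      rw [KD, hp0, hq0]
      have : 0 < (G p0 q0 q - G p0 q0 p) * D p0 q0 b := mul_pos (by linarith) hb0
      linarith
  refine hole_of s hpP hqP ha hb fun r hr hh => ?_
  obtain ⟨r1, r2, r3, r4⟩ := hull_D4 s hh
  have hle : Le p0 q0 r m := by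
    have : convexHull ℝ ({p, q, a, b} : Set Pt) ⊆ {r : Pt | Le p0 q0 r m} := by
      apply convexHull_min _ (convLe p0 q0 m)
      rintro x (rfl | rfl | rfl | rfl)
      · left; rw [hp0]; exact hm0
      · left; rw [hq0]; exact hm0
      · exact ham
      · exact hbm
    exact this hh
  have hr0 : 0 ≤ D p0 q0 r := by
    have h1 : 0 ≤ K p0 q0 * D p q r := mul_nonneg hK.le r1
    rw [KD, hp0, hq0] at h1
    have h2 : 0 ≤ (G p0 q0 q - G p0 q0 p) * D p0 q0 r := by linarith
    exact nonneg_of_mul_nonneg_right h2 (by linarith)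
  rcases hr0.eq_or_lt with hr0 | hr0
  swap
  · rcases hm r hr hr0 hle with h | h <;> tauto
  have gq : G p0 q0 r ≤ G p0 q0 q := by
    have h1 : 0 ≤ K p0 q0 * D q a r := mul_nonneg hK.le r2
    rw [KD, ← hr0, hq0] at h1
    have h2 : 0 ≤ D p0 q0 a * (G p0 q0 q - G p0 q0 r) := by linarith
    have := nonneg_of_mul_nonneg_right h2 ha0
    linarith
  have gp : G p0 q0 p ≤ G p0 q0 r := by
    have h1 : 0 ≤ K p0 q0 * D b p r := mul_nonneg hK.le r4
    rw [KD, ← hr0, hp0] at h1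
    have h2 : 0 ≤ D p0 q0 b * (G p0 q0 r - G p0 q0 p) := by linarith
    have := nonneg_of_mul_nonneg_right h2 hb0
    linarith
  have hab : 0 < D a b r := by
    have e : (G p0 q0 q - G p0 q0 p) * D a b r = (G p0 q0 q - G p0 q0 r) * D a b p
        + (G p0 q0 r - G p0 q0 p) * D a b q := by
      apply mul_left_cancel₀ hK.ne'
      have k1 := KD p0 q0 a b r
      have k2 := KD p0 q0 a b p
      have k3 := KD p0 q0 a b q
      rw [← hr0] at k1
      rw [hp0] at k2
      rw [hq0] at k3
      linear_combination (G p0 q0 q - G p0 q0 p) * k1 - (G p0 q0 q - G p0 q0 r) * k2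
        - (G p0 q0 r - G p0 q0 p) * k3
    have : 0 < (G p0 q0 q - G p0 q0 p) * D a b r := by
      rw [e]
      rcases gq.eq_or_lt with g | g
      · have : 0 < (G p0 q0 r - G p0 q0 p) * D a b q := mul_pos (by linarith) hqab
        rw [g] at *
        linarith
      · have h1 : 0 < (G p0 q0 q - G p0 q0 r) * D a b p := mul_pos (by linarith) hpab
        have h2 : 0 ≤ (G p0 q0 r - G p0 q0 p) * D a b q := mul_nonneg (by linarith) hqab.le
        linarith
    exact pos_of_mul_pos_right this (by linarith)
  by_cases hrp : r = p
  · exact Or.inl hrp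
  · right; left
    have := qmin r (Finset.mem_erase.2 ⟨hrp, Finset.mem_filter.2 ⟨hr, hr0.symm, hab⟩⟩)
    exact GH_ext hpq (by rw [← hr0, hq0]) (le_antisymm gq this)

lemma c2 {P : Finset Pt} {p0 q0 : Pt} (hpq : p0 ≠ q0)
    (hS : 4 ≤ (P.filter fun r => D p0 q0 r = 0).card)
    (hU : 2 ≤ (P.filter fun r => 0 < D p0 q0 r).card) :
    ∃ X : Finset Pt, IsHole P X 4 := by
  have hK := K_pos hpq
  set U := P.filter fun r => 0 < D p0 q0 r with hUdef
  obtain ⟨a, ha, amin⟩ := exists_lex p0 q0 U (Finset.card_pos.1 (by omega))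
  obtain ⟨b, hb, bmin⟩ := exists_lex p0 q0 (U.erase a)
    (Finset.card_pos.1 (by rw [Finset.card_erase_of_mem ha]; omega))
  obtain ⟨hba, hb⟩ := Finset.mem_erase.1 hb
  have hab := amin b hb
  obtain ⟨haP, ha0⟩ := Finset.mem_filter.1 ha
  obtain ⟨hbP, hb0⟩ := Finset.mem_filter.1 hb
  have hbb : Le p0 q0 b b := Or.inr ⟨rfl, le_rfl⟩
  have hm : ∀ r ∈ P, 0 < D p0 q0 r → Le p0 q0 r b → r = a ∨ r = b := by
    intro r hr hr0 hle
    by_cases hra : r = a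
    · exact Or.inl hra
    · right
      have h2 := bmin r (Finset.mem_erase.2 ⟨hra, Finset.mem_filter.2 ⟨hr, hr0⟩⟩)
      rcases hle with h | ⟨h, h'⟩ <;> rcases h2 with g | ⟨g, g'⟩
      · linarith
      · linarith
      · linarith
      · exact GH_ext hpq h (le_antisymm h' g')
  by_cases f1 : 2 ≤ (P.filter fun r => D p0 q0 r = 0 ∧ 0 < D a b r).card
  · exact c1 hpq haP hbP ha0 hb0 hb0 hab hbb hm f1
  by_cases f2 : 2 ≤ (P.filter fun r => D p0 q0 r = 0 ∧ 0 < D b a r).card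
  · exact c1 hpq hbP haP hb0 ha0 hb0 hbb hab (fun r h1 h2 h3 => (hm r h1 h2 h3).symm) f2
  exfalso
  have f3 : (P.filter fun r => D p0 q0 r = 0 ∧ D a b r = 0).card ≤ 1 := by
    rw [Finset.card_le_one]
    intro r hr s hs
    obtain ⟨hr, hr0, hr1⟩ := Finset.mem_filter.1 hr
    obtain ⟨hs, hs0, hs1⟩ := Finset.mem_filter.1 hs
    by_contra hne
    have k1 := KD p0 q0 a b r
    have k2 := KD p0 q0 a b s
    rw [hr0, hr1] at k1
    rw [hs0, hs1] at k2
    have hG : G p0 q0 r - G p0 q0 s ≠ 0 := fun h =>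
      hne (GH_ext hpq (hr0.trans hs0.symm) (by linarith))
    have e1 : (D p0 q0 b - D p0 q0 a) * (G p0 q0 r - G p0 q0 s) = 0 := by linarith
    have e2 := (mul_eq_zero.1 e1).resolve_right hG
    rw [e2] at k1
    have e3 : (G p0 q0 b - G p0 q0 a) * D p0 q0 a = 0 := by linarith
    have e4 := (mul_eq_zero.1 e3).resolve_right ha0.ne'
    exact hba (GH_ext hpq (by linarith) (by linarith))
  have hsub : (P.filter fun r => D p0 q0 r = 0) ⊆
      ((P.filter fun r => D p0 q0 r = 0 ∧ 0 < D a b r) ∪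
        (P.filter fun r => D p0 q0 r = 0 ∧ 0 < D b a r)) ∪
        (P.filter fun r => D p0 q0 r = 0 ∧ D a b r = 0) := by
    intro r hr
    obtain ⟨hr, hr0⟩ := Finset.mem_filter.1 hr
    simp only [Finset.mem_union, Finset.mem_filter]
    have := D_swap b a r
    rcases lt_trichotomy (D a b r) 0 with h | h | h
    · exact Or.inl (Or.inr ⟨hr, hr0, by linarith⟩)
    · exact Or.inr ⟨hr, hr0, h⟩
    · exact Or.inl (Or.inl ⟨hr, hr0, h⟩)
  have g1 := Finset.card_le_card hsub
  have g2 := Finset.card_union_le ((P.filter fun r => D p0 q0 r = 0 ∧ 0 < D a b r) ∪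
        (P.filter fun r => D p0 q0 r = 0 ∧ 0 < D b a r))
        (P.filter fun r => D p0 q0 r = 0 ∧ D a b r = 0)
  have g3 := Finset.card_union_le (P.filter fun r => D p0 q0 r = 0 ∧ 0 < D a b r)
        (P.filter fun r => D p0 q0 r = 0 ∧ 0 < D b a r)
  omega

lemma case1 {P : Finset Pt} {p0 q0 : Pt} (hpq : p0 ≠ q0)
    (hS : 4 ≤ (P.filter fun r => D p0 q0 r = 0).card)
    (hU : (P.filter fun r => D p0 q0 r = 0).card + 3 ≤ P.card) :
    ∃ X : Finset Pt, IsHole P X 4 := by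
  by_cases h1 : 2 ≤ (P.filter fun r => 0 < D p0 q0 r).card
  · exact c2 hpq hS h1
  by_cases h2 : 2 ≤ (P.filter fun r => 0 < D q0 p0 r).card
  · refine c2 hpq.symm ?_ h2
    have : (P.filter fun r => D q0 p0 r = 0) = (P.filter fun r => D p0 q0 r = 0) := by
      apply Finset.filter_congr
      intro r _
      rw [D_swap, neg_eq_zero]
    rw [this]; exact hS
  exfalso
  have hsub : P ⊆ ((P.filter fun r => D p0 q0 r = 0) ∪ (P.filter fun r => 0 < D p0 q0 r)) ∪
      (P.filter fun r => 0 < D q0 p0 r) := by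
    intro r hr
    simp only [Finset.mem_union, Finset.mem_filter]
    have := D_swap q0 p0 r
    rcases lt_trichotomy (D p0 q0 r) 0 with h | h | h
    · exact Or.inr ⟨hr, by linarith⟩
    · exact Or.inl (Or.inl ⟨hr, h⟩)
    · exact Or.inl (Or.inr ⟨hr, h⟩)
  have g1 := Finset.card_le_card hsub
  have g2 := Finset.card_union_le ((P.filter fun r => D p0 q0 r = 0) ∪
    (P.filter fun r => 0 < D p0 q0 r)) (P.filter fun r => 0 < D q0 p0 r)
  have g3 := Finset.card_union_le (P.filter fun r => D p0 q0 r = 0)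
    (P.filter fun r => 0 < D p0 q0 r)
  omega

lemma coll {p q : Pt} (h : p ≠ q) (S : Set Pt) (hS : ∀ r ∈ S, D p q r = 0) : Collinear ℝ S := by
  have hK := K_pos h
  rw [collinear_iff_exists_forall_eq_smul_vadd]
  refine ⟨p, q - p, fun r hr => ⟨(G p q r - G p q p) / K p q, ?_⟩⟩
  have h0 := hS r hr
  apply pt_ext
  · simp only [vadd_eq_add, PiLp.add_apply, PiLp.smul_apply, PiLp.sub_apply, smul_eq_mul]
    field_simp
    have : K p q * (r 0 - p 0) = (q 0 - p 0) * (G p q r - G p q p)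
          - (q 1 - p 1) * (D p q r) := by simp only [K, D, G]; ring
    rw [h0] at this; linarith
  · simp only [vadd_eq_add, PiLp.add_apply, PiLp.smul_apply, PiLp.sub_apply, smul_eq_mul]
    field_simp
    have : K p q * (r 1 - p 1) = (q 1 - p 1) * (G p q r - G p q p)
          + (q 0 - p 0) * (D p q r) := by simp only [K, D, G]; ring
    rw [h0] at this; linarith

end S14

end

theorem stmt14 (l : ℕ) (hl : 2 ≤ l) (P : Finset Pt)
    (hP : max 7 (l + 2) ≤ P.card) :
    HasCollinear P l ∨ ∃ X : Finset Pt, IsHole P X 4 := by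
  have h7 : 7 ≤ P.card := le_trans (le_max_left _ _) hP
  have hl2 : l + 2 ≤ P.card := le_trans (le_max_right _ _) hP
  by_cases h4 : S14.No4 P
  · exact Or.inr (S14.case2 h4 h7)
  simp only [S14.No4] at h4
  push Not at h4
  obtain ⟨a, ha, b, hb, c, hc, d, hd, n1, n2, n3, n4, n5, n6, h1, h2, -⟩ := h4
  by_cases hcard : l ≤ (P.filter fun r => S14.D a b r = 0).card
  · left
    obtain ⟨S, hS, hSc⟩ := Finset.exists_subset_card_eq hcard
    exact ⟨S, fun x hx => (Finset.mem_filter.1 (hS hx)).1, hSc,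
      S14.coll n1 _ fun r hr => (Finset.mem_filter.1 (hS hr)).2⟩
  · right
    refine S14.case1 n1 ?_ (by omega)
    have : ({a, b, c, d} : Finset Pt) ⊆ P.filter fun r => S14.D a b r = 0 := by
      intro x hx
      simp only [Finset.mem_insert, Finset.mem_singleton] at hx
      rcases hx with rfl | rfl | rfl | rfl
      · exact Finset.mem_filter.2 ⟨ha, S14.D_self1 _ _⟩
      · exact Finset.mem_filter.2 ⟨hb, S14.D_self2 _ _⟩
      · exact Finset.mem_filter.2 ⟨hc, h1⟩
      · exact Finset.mem_filter.2 ⟨hd, h2⟩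
    have h := Finset.card_le_card this
    rwa [show ({a, b, c, d} : Finset Pt).card = 4 by simp [*]] at h
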